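/- arXiv:0909.1897 — 3 statements merged into one kernel-verified Lean document; each statement's English description precedes it below -/
import Mathlib

section
/- Let n ≥ 1, let Ω ⊆ ℝⁿ be open, and let u : Ω → ℝ be three times continuously differentiable. Let H(x) denote the Hessian matrix (∂ₚ∂_q u(x)) of u at x, and let adj H(x) denote its adjugate matrix. Then for every x ∈ Ω and every index i, ∂ᵢ(u^{n+2}·det H)(x) = (1/2)·u(x)^{n+1}·Σ_{p,q=1}^{n} (adj H(x))_{pq}·∂ᵢ∂ₚ∂_q(u²)(x). -/
/-- The partial derivative `∂ᵢ f` of a function on `ℝⁿ` in the `i`-th coordinate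
direction. -/
noncomputable def pd {n : ℕ} (i : Fin n) (f : (Fin n → ℝ) → ℝ) : (Fin n → ℝ) → ℝ :=
  fun x => fderiv ℝ f x (Pi.single i 1)

open Finset in
/-- Jacobi's formula for the derivative of a determinant. -/
theorem HasFDerivAt.matrix_det {E m : Type*} [NormedAddCommGroup E] [NormedSpace ℝ E]
    [Fintype m] [DecidableEq m] {A : E → Matrix m m ℝ} {A' : m → m → E →L[ℝ] ℝ} {x : E}
    (h : ∀ p q, HasFDerivAt (fun y => A y p q) (A' p q) x) :
    HasFDerivAt (fun y => (A y).det) (∑ p, ∑ q, (A x).adjugate p q • A' q p) x := by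
  have key : HasFDerivAt (fun y => ∑ σ : Equiv.Perm m,
      ((Equiv.Perm.sign σ : ℤ) : ℝ) * ∏ j, A y (σ j) j)
      (∑ σ : Equiv.Perm m, ((Equiv.Perm.sign σ : ℤ) : ℝ) •
        ∑ k, (∏ j ∈ univ.erase k, A x (σ j) j) • A' (σ k) k) x :=
    HasFDerivAt.fun_sum fun σ _ =>
      (HasFDerivAt.finsetProd fun j _ => h (σ j) j).const_mul _
  simp only [Matrix.det_apply']
  refine key.congr_fderiv ?_
  ext v
  have expand (p : m) : ∑ q, (A x).adjugate p q * A' q p v =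
      ∑ σ : Equiv.Perm m, ((Equiv.Perm.sign σ : ℤ) : ℝ) *
        ((∏ j ∈ univ.erase p, A x (σ j) j) * A' (σ p) p v) := by
    have hc : ∑ q, (A x).adjugate p q * A' q p v =
        ((A x).updateCol p fun q => A' q p v).det := by
      rw [← Matrix.cramer_apply, Matrix.cramer_eq_adjugate_mulVec]
      rfl
    rw [hc, Matrix.det_apply']
    refine sum_congr rfl fun σ _ => ?_
    rw [← prod_erase_mul _ _ (mem_univ p), Matrix.updateCol_self]
    congr 2
    refine prod_congr rfl fun j hj => ?_
    rw [Matrix.updateCol_ne (ne_of_mem_erase hj)]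
  simp only [_root_.sum_apply, smul_apply, smul_eq_mul,
    expand, mul_sum]
  exact sum_comm

section PartialDerivative

variable {n : ℕ} {Ω : Set (Fin n → ℝ)} {f g : (Fin n → ℝ) → ℝ} {x : Fin n → ℝ}

theorem HasFDerivAt.pd_eq {f' : (Fin n → ℝ) →L[ℝ] ℝ} (h : HasFDerivAt f f' x) (i : Fin n) :
    pd i f x = f' (Pi.single i 1) := by
  rw [pd, h.fderiv]

theorem pd_add (hf : DifferentiableAt ℝ f x) (hg : DifferentiableAt ℝ g x) (i : Fin n) :
    pd i (fun y => f y + g y) x = pd i f x + pd i g x :=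
  (hf.hasFDerivAt.fun_add hg.hasFDerivAt).pd_eq i

theorem pd_mul (hf : DifferentiableAt ℝ f x) (hg : DifferentiableAt ℝ g x) (i : Fin n) :
    pd i (fun y => f y * g y) x = f x * pd i g x + pd i f x * g x := by
  rw [(hf.hasFDerivAt.fun_mul hg.hasFDerivAt).pd_eq i]
  simp [pd, mul_comm]

theorem pd_pow (hf : DifferentiableAt ℝ f x) (k : ℕ) (i : Fin n) :
    pd i (fun y => f y ^ (k + 1)) x = (k + 1) * f x ^ k * pd i f x := by
  rw [(hf.hasFDerivAt.pow (k + 1)).pd_eq i]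
  simp [pd]

theorem Set.EqOn.pd (h : Set.EqOn f g Ω) (hΩ : IsOpen Ω) (i : Fin n) :
    Set.EqOn (pd i f) (pd i g) Ω := fun y hy => by
  simp only [_root_.pd, (h.eventuallyEq_of_mem (hΩ.mem_nhds hy)).fderiv_eq]

theorem ContDiffOn.pd {k l : WithTop ℕ∞} (h : ContDiffOn ℝ l f Ω) (hΩ : IsOpen Ω)
    (hkl : k + 1 ≤ l) (i : Fin n) : ContDiffOn ℝ k (pd i f) Ω :=
  (h.fderiv_of_isOpen hΩ hkl).clm_apply contDiffOn_const

theorem pd_comm (h : ContDiffAt ℝ 2 f x) (i j : Fin n) :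
    pd i (pd j f) x = pd j (pd i f) x := by
  have hd : DifferentiableAt ℝ (fderiv ℝ f) x :=
    (h.fderiv_right (m := 1) (by norm_num)).differentiableAt (by norm_num)
  have second (a b : Fin n) : pd a (pd b f) x =
      fderiv ℝ (fderiv ℝ f) x (Pi.single a 1) (Pi.single b 1) := by
    refine ((hd.hasFDerivAt.clm_apply
      (hasFDerivAt_const (Pi.single b (1 : ℝ)) x)).pd_eq a).trans ?_
    simp
  rw [second, second]
  exact (h.isSymmSndFDerivAt (by simp)).eq _ _

/-- The third partial derivatives of the square of a `C³` function. -/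
theorem pd_pd_pd_sq (hΩ : IsOpen Ω) (hf : ContDiffOn ℝ 3 f Ω) (hx : x ∈ Ω) (i p q : Fin n) :
    pd i (pd p (pd q fun y => f y ^ 2)) x =
      2 * (f x * pd i (pd p (pd q f)) x + pd i f x * pd p (pd q f) x +
        pd p f x * pd i (pd q f) x + pd i (pd p f) x * pd q f x) := by
  have diff {g : (Fin n → ℝ) → ℝ} (hg : ContDiffOn ℝ 1 g Ω) {y} (hy : y ∈ Ω) :
      DifferentiableAt ℝ g y :=
    (hg.contDiffAt (hΩ.mem_nhds hy)).differentiableAt (by norm_num)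
  have h0 : ContDiffOn ℝ 1 f Ω := hf.of_le (by norm_num)
  have h1 (a : Fin n) : ContDiffOn ℝ 2 (pd a f) Ω := hf.pd hΩ (by norm_num) a
  have h1' (a : Fin n) : ContDiffOn ℝ 1 (pd a f) Ω := (h1 a).of_le (by norm_num)
  have h2 (a b : Fin n) : ContDiffOn ℝ 1 (pd a (pd b f)) Ω := (h1 b).pd hΩ (by norm_num) a
  have first : Set.EqOn (pd q fun y => f y ^ 2) (fun y => f y * pd q f y + f y * pd q f y) Ω :=
    fun y hy => by
      rw [pd_pow (diff h0 hy) 1 q]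
      push_cast
      ring
  have second : Set.EqOn (pd p (pd q fun y => f y ^ 2))
      (fun y => (f y * pd p (pd q f) y + pd p f y * pd q f y) +
        (f y * pd p (pd q f) y + pd p f y * pd q f y)) Ω := fun y hy => by
    have hm := (diff h0 hy).fun_mul (diff (h1' q) hy)
    rw [first.pd hΩ p hy, pd_add hm hm, pd_mul (diff h0 hy) (diff (h1' q) hy)]
  have ha := (diff h0 hx).fun_mul (diff (h2 p q) hx)
  have hb := (diff (h1' p) hx).fun_mul (diff (h1' q) hx)
  rw [second.pd hΩ i hx, pd_add (ha.fun_add hb) (ha.fun_add hb), pd_add ha hb,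
    pd_mul (diff h0 hx) (diff (h2 p q) hx), pd_mul (diff (h1' p) hx) (diff (h1' q) hx)]
  ring

end PartialDerivative

/-- The key identity behind the projectively invariant Monge–Ampère operator, in flat
coordinates: for a `C³` function `u` on an open set `Ω ⊆ ℝⁿ` with Hessian matrix `H`,
`∂ᵢ(u^{n+2}·det H) = (1/2)·u^{n+1}·Σ_{p,q} (adj H)_{pq}·∂ᵢ∂ₚ∂_q(u²)`. -/
theorem mongeAmpere_derivative_identity {n : ℕ} (hn : 1 ≤ n)
    (Ω : Set (Fin n → ℝ)) (hΩ : IsOpen Ω)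
    (u : (Fin n → ℝ) → ℝ) (hu : ContDiffOn ℝ 3 u Ω)
    (x : Fin n → ℝ) (hx : x ∈ Ω) (i : Fin n) :
    pd i (fun y => u y ^ (n + 2) * (Matrix.of fun p q => pd p (pd q u) y).det) x =
      (1 / 2) * u x ^ (n + 1) *
        ∑ p : Fin n, ∑ q : Fin n,
          (Matrix.adjugate (Matrix.of fun a b => pd a (pd b u) x)) p q *
            pd i (pd p (pd q (fun y => u y ^ 2))) x := by
  have hxΩ := hΩ.mem_nhds hx
  have hux : ContDiffAt ℝ 3 u x := hu.contDiffAt hxΩ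
  have hd : DifferentiableAt ℝ u x := hux.differentiableAt (by norm_num)
  have hd2 (p q : Fin n) : DifferentiableAt ℝ (pd p (pd q u)) x :=
    (((hu.pd (k := 2) hΩ (by norm_num) q).pd (k := 1) hΩ (by norm_num) p).contDiffAt
      hxΩ).differentiableAt (by norm_num)
  have hsymm (p q : Fin n) : pd p (pd q u) x = pd q (pd p u) x :=
    pd_comm (hux.of_le (by norm_num)) p q
  have hsymm3 (p q : Fin n) : pd i (pd p (pd q u)) x = pd i (pd q (pd p u)) x := by
    have h : Set.EqOn (pd p (pd q u)) (pd q (pd p u)) Ω := fun y hy =>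
      pd_comm ((hu.contDiffAt (hΩ.mem_nhds hy)).of_le (by norm_num)) p q
    exact h.pd hΩ i hx
  have hdet := HasFDerivAt.matrix_det (A := fun y => Matrix.of fun p q => pd p (pd q u) y)
    fun p q => (hd2 p q).hasFDerivAt
  rw [pd_mul (hd.fun_pow _) hdet.differentiableAt, hdet.pd_eq i, pd_pow hd (n + 1) i]
  simp only [pd_pd_pd_sq hΩ hu hx]
  set H : Matrix (Fin n) (Fin n) ℝ := Matrix.of fun p q => pd p (pd q u) x with hH
  have hentry (p q : Fin n) : pd p (pd q u) x = H p q := rfl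
  have jacobi : (∑ p, ∑ q, H.adjugate p q • fderiv ℝ (pd q (pd p u)) x) (Pi.single i 1) =
      ∑ p, ∑ q, H.adjugate p q * pd i (pd p (pd q u)) x := by
    simp only [sum_apply, smul_apply, smul_eq_mul]
    exact Finset.sum_congr rfl fun p _ => Finset.sum_congr rfl fun q _ => by
      rw [hsymm3 p q, pd]
  have left (p r : Fin n) : ∑ q, H.adjugate p q * H q r = if p = r then H.det else 0 := by
    rw [← Matrix.mul_apply, Matrix.adjugate_mul, Matrix.smul_apply, Matrix.one_apply]
    simp
  have right (r q : Fin n) : ∑ p, H r p * H.adjugate p q = if r = q then H.det else 0 := by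
    rw [← Matrix.mul_apply, Matrix.mul_adjugate, Matrix.smul_apply, Matrix.one_apply]
    simp
  have trace : ∑ p, ∑ q, H.adjugate p q * H p q = n * H.det := by
    have (p : Fin n) : ∑ q, H.adjugate p q * H p q = H.det := by
      rw [← (left p p).trans (if_pos rfl)]
      exact Finset.sum_congr rfl fun q _ => by rw [show H p q = H q p from hsymm p q]
    simp [this]
  have mixed_left : ∑ p, ∑ q, H.adjugate p q * (pd p u x * H i q) = pd i u x * H.det := by
    have (p : Fin n) : ∑ q, H.adjugate p q * (pd p u x * H i q) =
        pd p u x * if p = i then H.det else 0 := by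
      rw [← left, Finset.mul_sum]
      exact Finset.sum_congr rfl fun q _ => by
        rw [show H i q = H q i from hsymm i q]
        ring
    simp [this]
  have mixed_right : ∑ p, ∑ q, H.adjugate p q * (H i p * pd q u x) = pd i u x * H.det := by
    have (q : Fin n) : ∑ p, H.adjugate p q * (H i p * pd q u x) =
        pd q u x * if i = q then H.det else 0 := by
      rw [← right, Finset.mul_sum]
      exact Finset.sum_congr rfl fun p _ => by ring
    rw [Finset.sum_comm]
    simp [this]
  have split : ∑ p, ∑ q, H.adjugate p q *
      (2 * (u x * pd i (pd p (pd q u)) x + pd i u x * pd p (pd q u) x +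
        pd p u x * pd i (pd q u) x + pd i (pd p u) x * pd q u x)) =
      2 * (u x * ∑ p, ∑ q, H.adjugate p q * pd i (pd p (pd q u)) x +
        pd i u x * ∑ p, ∑ q, H.adjugate p q * H p q +
        ∑ p, ∑ q, H.adjugate p q * (pd p u x * H i q) +
        ∑ p, ∑ q, H.adjugate p q * (H i p * pd q u x)) := by
    simp only [hentry, Finset.mul_sum, ← Finset.sum_add_distrib]
    exact Finset.sum_congr rfl fun p _ => Finset.sum_congr rfl fun q _ => by ring
  rw [jacobi, split, trace, mixed_left, mixed_right]
  push_cast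
  ring
end

section
/- Let A be a finite-dimensional real vector space with a bilinear multiplication ∘ and let h be a bilinear form on A; let (Â_h, ∘̂, ĥ) be the unitalization. Then: (i) ĥ is nondegenerate if and only if h is nondegenerate, and ĥ is left invariant if and only if h is left invariant — so (Â_h, ĥ) is a unital Frobenius algebra if and only if (A,h) is a Frobenius algebra. Moreover, (ii) when (A,h) is a Frobenius algebra, the following are equivalent: ĥ is braided; ĥ is symmetric; h is symmetric and braided. -/
/-- A finite-dimensional real vector space with a bilinear multiplication and a bilinear
form (no associativity, commutativity, or unit assumed). -/
structure BilinAlg (A : Type*) [AddCommGroup A] [Module ℝ A] where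
  mul : A →ₗ[ℝ] A →ₗ[ℝ] A
  form : A →ₗ[ℝ] A →ₗ[ℝ] ℝ

namespace BilinAlg

variable {A : Type*} [AddCommGroup A] [Module ℝ A]

/-- Left invariance of the bilinear form: `h(x∘y, z) = h(x, y∘z)`. -/
def LeftInvariant (F : BilinAlg A) : Prop :=
  ∀ x y z, F.form (F.mul x y) z = F.form x (F.mul y z)

/-- Right invariance of the bilinear form: `h(x, y∘z) = h(z∘x, y)`. -/
def RightInvariant (F : BilinAlg A) : Prop :=
  ∀ x y z, F.form x (F.mul y z) = F.form (F.mul z x) y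

/-- A braided bilinear form is one which is both left and right invariant. -/
def Braided (F : BilinAlg A) : Prop := F.LeftInvariant ∧ F.RightInvariant

/-- Symmetry of the bilinear form. -/
def Symm (F : BilinAlg A) : Prop := ∀ x y, F.form x y = F.form y x

/-- Nondegeneracy of the bilinear form in both slots. -/
def Nondeg (F : BilinAlg A) : Prop :=
  (∀ x, (∀ y, F.form x y = 0) → x = 0) ∧ (∀ y, (∀ x, F.form x y = 0) → y = 0)

/-- A Frobenius algebra: the form is nondegenerate and left invariant. -/
def IsFrobenius (F : BilinAlg A) : Prop := F.Nondeg ∧ F.LeftInvariant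

/-- The unitalization `Â_h = A ⊕ ℝ` with multiplication
`(x,λ)∘̂(y,μ) = (x∘y + λy + μx, h(x,y) + λμ)` and form `ĥ((x,λ),(y,μ)) = h(x,y) + λμ`. -/
noncomputable def hat (F : BilinAlg A) : BilinAlg (A × ℝ) where
  mul := LinearMap.mk₂ ℝ
    (fun u v => (F.mul u.1 v.1 + u.2 • v.1 + v.2 • u.1, F.form u.1 v.1 + u.2 * v.2))
    (fun u u' v => by
      simp only [Prod.fst_add, Prod.snd_add, map_add, LinearMap.add_apply, add_smul,
        smul_add, add_mul, Prod.mk_add_mk, Prod.mk.injEq]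
      exact ⟨by abel, by ring⟩)
    (fun c u v => by
      simp only [Prod.smul_fst, Prod.smul_snd, map_smul, LinearMap.smul_apply,
        smul_eq_mul, Prod.smul_mk, Prod.mk.injEq]
      exact ⟨by module, by ring⟩)
    (fun u v v' => by
      simp only [Prod.fst_add, Prod.snd_add, map_add, LinearMap.add_apply, smul_add,
        add_smul, mul_add, Prod.mk_add_mk, Prod.mk.injEq]
      exact ⟨by abel, by ring⟩)
    (fun c u v => by
      simp only [Prod.smul_fst, Prod.smul_snd, map_smul, LinearMap.smul_apply,
        smul_eq_mul, Prod.smul_mk, Prod.mk.injEq]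
      exact ⟨by module, by ring⟩)
  form := LinearMap.mk₂ ℝ
    (fun u v => F.form u.1 v.1 + u.2 * v.2)
    (fun u u' v => by
      simp only [Prod.fst_add, Prod.snd_add, map_add, LinearMap.add_apply, add_mul]; ring)
    (fun c u v => by
      simp only [Prod.smul_fst, Prod.smul_snd, map_smul, LinearMap.smul_apply,
        smul_eq_mul]; ring)
    (fun u v v' => by
      simp only [Prod.fst_add, Prod.snd_add, map_add, LinearMap.add_apply, mul_add]; ring)
    (fun c u v => by
      simp only [Prod.smul_fst, Prod.smul_snd, map_smul, LinearMap.smul_apply,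
        smul_eq_mul]; ring)

end BilinAlg

namespace BilinAlg

variable {A : Type*} [AddCommGroup A] [Module ℝ A]

@[simp]
theorem hat_mul_apply (F : BilinAlg A) (u v : A × ℝ) :
    F.hat.mul u v =
      (F.mul u.1 v.1 + u.2 • v.1 + v.2 • u.1, F.form u.1 v.1 + u.2 * v.2) :=
  rfl

@[simp]
theorem hat_form_apply (F : BilinAlg A) (u v : A × ℝ) :
    F.hat.form u v = F.form u.1 v.1 + u.2 * v.2 :=
  rfl

theorem hat_one_mul (F : BilinAlg A) (u : A × ℝ) : F.hat.mul ((0 : A), (1 : ℝ)) u = u := by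
  simp

theorem hat_mul_one (F : BilinAlg A) (u : A × ℝ) : F.hat.mul u ((0 : A), (1 : ℝ)) = u := by
  simp

theorem hat_nondeg_iff (F : BilinAlg A) : F.hat.Nondeg ↔ F.Nondeg := by
  constructor
  · rintro ⟨hl, hr⟩
    refine ⟨fun x hx => ?_, fun y hy => ?_⟩
    · exact congrArg Prod.fst (hl (x, 0) fun v => by simp [hx])
    · exact congrArg Prod.fst (hr (y, 0) fun u => by simp [hy])
  · rintro ⟨hl, hr⟩
    refine ⟨fun u hu => Prod.ext (hl _ fun y => ?_) ?_, fun v hv => Prod.ext (hr _ fun x => ?_) ?_⟩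
    · simpa using hu (y, 0)
    · simpa using hu (0, 1)
    · simpa using hv (x, 0)
    · simpa using hv (0, 1)

theorem hat_leftInvariant_iff (F : BilinAlg A) : F.hat.LeftInvariant ↔ F.LeftInvariant := by
  constructor
  · intro h x y z
    simpa using h (x, 0) (y, 0) (z, 0)
  · intro h u v w
    simp only [hat_form_apply, hat_mul_apply, map_add, map_smul, LinearMap.add_apply,
      LinearMap.smul_apply, smul_eq_mul, h u.1 v.1 w.1]
    ring

theorem hat_isFrobenius_iff (F : BilinAlg A) : F.hat.IsFrobenius ↔ F.IsFrobenius :=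
  and_congr F.hat_nondeg_iff F.hat_leftInvariant_iff

theorem hat_symm_iff (F : BilinAlg A) : F.hat.Symm ↔ F.Symm := by
  constructor
  · intro h x y
    simpa using h (x, 0) (y, 0)
  · intro h u v
    rw [hat_form_apply, hat_form_apply, h, mul_comm]

theorem LeftInvariant.braided {F : BilinAlg A} (hF : F.LeftInvariant) (hs : F.Symm) :
    F.Braided :=
  ⟨hF, fun x y z => by rw [hs x, hF, hs y]⟩

/-- A braided form on an algebra with a two-sided unit is symmetric. -/
theorem Braided.symm_of_unit {F : BilinAlg A} (hF : F.Braided) {e : A}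
    (one_mul : ∀ x, F.mul e x = x) (mul_one : ∀ x, F.mul x e = x) : F.Symm := by
  intro x y
  calc F.form x y = F.form (F.mul y x) e := by rw [← hF.2 x e y, one_mul]
    _ = F.form y x := by rw [hF.1, mul_one]

end BilinAlg

/-- Properties of the unitalization of an algebra with a bilinear form: `ĥ` is nondegenerate
iff `h` is, `ĥ` is left invariant iff `h` is (so the unitalization is a unital Frobenius
algebra iff `(A,h)` is Frobenius, `(0,1)` being a two-sided unit); and when `(A,h)` is
Frobenius: `ĥ` is braided iff `ĥ` is symmetric iff `h` is symmetric and braided. -/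
theorem unitalization_frobenius_properties
    {A : Type*} [AddCommGroup A] [Module ℝ A] [FiniteDimensional ℝ A]
    (F : BilinAlg A) :
    (F.hat.Nondeg ↔ F.Nondeg) ∧
    (F.hat.LeftInvariant ↔ F.LeftInvariant) ∧
    (F.hat.IsFrobenius ↔ F.IsFrobenius) ∧
    (∀ u : A × ℝ, F.hat.mul ((0 : A), (1 : ℝ)) u = u ∧ F.hat.mul u ((0 : A), (1 : ℝ)) = u) ∧
    (F.IsFrobenius →
      ((F.hat.Braided ↔ F.hat.Symm) ∧ (F.hat.Symm ↔ (F.Symm ∧ F.Braided)))) := by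
  refine ⟨F.hat_nondeg_iff, F.hat_leftInvariant_iff, F.hat_isFrobenius_iff,
    fun u => ⟨F.hat_one_mul u, F.hat_mul_one u⟩, fun hF => ⟨⟨fun hb => ?_, fun hs => ?_⟩, ?_⟩⟩
  · exact hb.symm_of_unit F.hat_one_mul F.hat_mul_one
  · exact (F.hat_leftInvariant_iff.mpr hF.2).braided hs
  · exact F.hat_symm_iff.trans ⟨fun hs => ⟨hs, hF.2.braided hs⟩, And.left⟩
end

section
/- Let (B, ∘, g) be a finite-dimensional real unital Frobenius algebra (bilinear multiplication with two-sided unit e and nondegenerate left-invariant bilinear form g) such that g(e,e) ≠ 0. Let A := {x ∈ B : g(x,e) = 0 and g(e,x) = 0}. Then: (i) A is closed under the multiplication x⋆y := x∘y − (g(x,y)/g(e,e))·e, i.e. x⋆y ∈ A for all x,y ∈ A; (ii) the restriction of g to A is nondegenerate; and (iii) g is left invariant for ⋆ on A: g(x⋆y, z) = g(x, y⋆z) for all x,y,z ∈ A. Hence (A, ⋆, g|_A) is a Frobenius algebra. -/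
/-- On a finite-dimensional real unital Frobenius algebra `(B, ∘, g)` with unit `e` of nonzero
norm, the orthogonal complement `A = {x : g(x,e) = 0 = g(e,x)}` of the unit with the modified
multiplication `x ⋆ y := x∘y − (g(x,y)/g(e,e))·e` and the restricted form is again a
Frobenius algebra: `A` is closed under `⋆`, the restriction of `g` to `A` is nondegenerate,
and `g` is left invariant for `⋆` on `A`. -/
theorem frobenius_unit_reduction {B : Type*} [AddCommGroup B] [Module ℝ B]
    [FiniteDimensional ℝ B]
    (mul : B →ₗ[ℝ] B →ₗ[ℝ] B) (g : B →ₗ[ℝ] B →ₗ[ℝ] ℝ) (e : B)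
    (hunit : ∀ x : B, mul e x = x ∧ mul x e = x)
    (hnd : (∀ x, (∀ y, g x y = 0) → x = 0) ∧ (∀ y, (∀ x, g x y = 0) → y = 0))
    (hleft : ∀ x y z, g (mul x y) z = g x (mul y z))
    (hee : g e e ≠ 0) :
    (∀ x y : B, (g x e = 0 ∧ g e x = 0) → (g y e = 0 ∧ g e y = 0) →
      (g (mul x y - (g x y / g e e) • e) e = 0 ∧
        g e (mul x y - (g x y / g e e) • e) = 0)) ∧
    (∀ x : B, (g x e = 0 ∧ g e x = 0) →
      (∀ y : B, (g y e = 0 ∧ g e y = 0) → g x y = 0) → x = 0) ∧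
    (∀ y : B, (g y e = 0 ∧ g e y = 0) →
      (∀ x : B, (g x e = 0 ∧ g e x = 0) → g x y = 0) → y = 0) ∧
    (∀ x y z : B, (g x e = 0 ∧ g e x = 0) → (g y e = 0 ∧ g e y = 0) →
      (g z e = 0 ∧ g e z = 0) →
      g (mul x y - (g x y / g e e) • e) z = g x (mul y z - (g y z / g e e) • e)) := by
  have hcomm : ∀ x, g e x = g x e := fun x => by
    simpa [(hunit x).1, (hunit x).2] using (hleft e x e).symm
  have hmul : ∀ x y, g (mul x y) e = g x y := fun x y => by
    rw [hleft, (hunit y).2]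
  have hproj : ∀ y, g (y - (g y e / g e e) • e) e = 0 ∧
      g e (y - (g y e / g e e) • e) = 0 := fun y => by
    simp [hcomm y, hee]
  refine ⟨fun x y _ _ => by simpa only [hmul] using hproj (mul x y),
    fun x hx h => hnd.1 x fun y => ?_, fun y hy h => hnd.2 y fun x => ?_,
    fun x y z hx _ hz => by simp [hleft, hx.1, hz.2]⟩
  · simpa [hx.1] using h _ (hproj y)
  · simpa [hy.2] using h _ (hproj x)
end
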